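/- Let k ≥ 2 be an integer. For every integer n ≥ k and every d ∈ ℕ, the word ω_{[d … d+|s_k^n(0)|−1]} (the subword of ω of length |s_k^n(0)| starting at position d) equals s_k^n(0) if and only if d ∈ D^n. -/

import Mathlib

/-- The `k`-bonacci substitution on letters: `a ↦ 0(a+1)` if `a ≠ k-1`, and `k-1 ↦ 0`. -/
def sLetter {k : ℕ} (a : Fin k) : List (Fin k) :=
  if h : (a : ℕ) + 1 < k then
    [⟨0, Nat.lt_of_le_of_lt (Nat.zero_le _) a.isLt⟩, ⟨(a : ℕ) + 1, h⟩]
  else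
    [⟨0, Nat.lt_of_le_of_lt (Nat.zero_le _) a.isLt⟩]

/-- Extension of the substitution to finite words by concatenation. -/
def sWord {k : ℕ} (w : List (Fin k)) : List (Fin k) := w.flatMap sLetter

/-- The prefix of length `n` of a right-infinite sequence. -/
def pref {k : ℕ} (x : ℕ → Fin k) (n : ℕ) : List (Fin k) :=
  (List.range n).map x

/-- Extension of the substitution to right-infinite sequences, by concatenating the
images of the letters: since each letter has a nonempty image, the `m`-th letter of the
image is the `m`-th letter of the image of the prefix of length `m+1`. -/
def sSeq {k : ℕ} (x : ℕ → Fin k) : ℕ → Fin k :=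
  fun m => (sWord (pref x (m + 1))).getD m (x 0)

/-- The left shift on sequences. -/
def shift {k : ℕ} (x : ℕ → Fin k) : ℕ → Fin k := fun n => x (n + 1)

/-- The language of the substitution: finite words occurring as a subword of some `s^m(a)`. -/
def Lang {k : ℕ} (w : List (Fin k)) : Prop :=
  ∃ (a : Fin k) (m : ℕ), w <:+: sWord^[m] [a]

/-- `delta x = sup {n : prefix of x of length n is in the language}`, valued in `ℕ∞`. -/
noncomputable def delta {k : ℕ} (x : ℕ → Fin k) : ℕ∞ :=
  sSup {N : ℕ∞ | ∃ n : ℕ, N = (n : ℕ∞) ∧ Lang (pref x n)}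

/-- The subshift associated to the substitution: sequences all of whose subwords
lie in the language. -/
def Attr (k : ℕ) : Set (ℕ → Fin k) :=
  {x | ∀ i n, Lang ((List.range n).map (fun j => x (i + j)))}

/-- The renormalization operator. -/
noncomputable def Renorm {k : ℕ} (V : (ℕ → Fin k) → ℝ) : (ℕ → Fin k) → ℝ :=
  fun x => ∑ j ∈ Finset.range (sLetter (x 0)).length, V (shift^[j] (sSeq x))

/-- `vcoef k lam l = lam^{-(k-1-l)} * ∑_{j=0}^{k-1-l} lam^j`. -/
noncomputable def vcoef (k : ℕ) (lam : ℝ) (l : ℕ) : ℝ :=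
  (∑ j ∈ Finset.range (k - l), lam ^ j) / lam ^ (k - 1 - l)

/-- The fixed point of the renormalization operator. -/
noncomputable def Ufix (k : ℕ) (lam : ℝ) (x : ℕ → Fin k) : ℝ :=
  if delta x = ⊤ then 0
  else Real.log (1 + vcoef k lam (x 0) /
    (lam / (lam - 1)
      + (∑ l : Fin k, vcoef k lam (l : ℕ) * ((pref x (delta x).toNat).count l : ℝ))
      - vcoef k lam (x 0)))

/-- The word `s^n(0) · s^{n-1}(0) ⋯ s(0) · 0`. -/
def bword {k : ℕ} (z : Fin k) (n : ℕ) : List (Fin k) :=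
  ((List.range (n + 1)).map (fun i => sWord^[n - i] [z])).flatten

/-- The word `s^{n-1}(0) · s^{n-2}(0) ⋯ s(0) · 0`. -/
def bsuffix {k : ℕ} (z : Fin k) (n : ℕ) : List (Fin k) :=
  ((List.range n).map (fun i => sWord^[n - 1 - i] [z])).flatten

/-- `OccursAt x w d` says that the word `w` is the subword of `x` starting at position `d`. -/
def OccursAt {k : ℕ} (x : ℕ → Fin k) : List (Fin k) → ℕ → Prop
  | [], _ => True
  | a :: w, d => x d = a ∧ OccursAt x w (d + 1)

/-- The position in `s(x)` at which the image of the `e`-th letter of `x` begins. -/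
def blockStart {k : ℕ} (x : ℕ → Fin k) (e : ℕ) : ℕ := (sWord (pref x e)).length

/-- The map `w ↦ s(w) z` on finite words. -/
def sWordSnoc {k : ℕ} (z : Fin k) (w : List (Fin k)) : List (Fin k) := sWord w ++ [z]

section Words

variable {k : ℕ}

theorem sWord_append (u v : List (Fin k)) : sWord (u ++ v) = sWord u ++ sWord v := by
  simp [sWord]

theorem sWord_cons (a : Fin k) (v : List (Fin k)) : sWord (a :: v) = sLetter a ++ sWord v := by
  simp [sWord]

theorem sWord_singleton (a : Fin k) : sWord [a] = sLetter a := by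
  simp [sWord]

theorem sLetter_of_lt {z a : Fin k} (hz : (z : ℕ) = 0) (h : (a : ℕ) + 1 < k) :
    sLetter a = [z, ⟨(a : ℕ) + 1, h⟩] := by
  have : z = ⟨0, Nat.lt_of_le_of_lt (Nat.zero_le _) a.isLt⟩ := Fin.ext hz
  simp [sLetter, h, this]

theorem sLetter_of_not_lt {z a : Fin k} (hz : (z : ℕ) = 0) (h : ¬ (a : ℕ) + 1 < k) :
    sLetter a = [z] := by
  have : z = ⟨0, Nat.lt_of_le_of_lt (Nat.zero_le _) a.isLt⟩ := Fin.ext hz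
  simp [sLetter, h, this]

theorem sLetter_length_pos (a : Fin k) : 0 < (sLetter a).length := by
  unfold sLetter
  split <;> simp

theorem length_le_length_sWord (w : List (Fin k)) : w.length ≤ (sWord w).length := by
  induction w with
  | nil => simp
  | cons a w ih =>
    have := sLetter_length_pos a
    rw [sWord_cons, List.length_append, List.length_cons]
    omega

theorem sWord_isPrefix {u v : List (Fin k)} (h : u <+: v) : sWord u <+: sWord v := by
  obtain ⟨t, rfl⟩ := h
  rw [sWord_append]
  exact List.prefix_append _ _

theorem length_pref (x : ℕ → Fin k) (n : ℕ) : (pref x n).length = n := by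
  simp [pref]

theorem pref_succ (x : ℕ → Fin k) (n : ℕ) : pref x (n + 1) = pref x n ++ [x n] := by
  simp [pref, List.range_succ]

theorem pref_isPrefix (x : ℕ → Fin k) {m n : ℕ} (h : m ≤ n) : pref x m <+: pref x n := by
  induction n, h using Nat.le_induction with
  | base => exact List.prefix_rfl
  | succ n _ ih =>
    rw [pref_succ]
    exact ih.trans (List.prefix_append _ _)

theorem iterate_sWord_append_singleton {z : Fin k} (hz : (z : ℕ) = 0) (y : List (Fin k))
    {r : ℕ} (hr : r < k) :
    sWord^[r] (y ++ [z]) = (sWordSnoc z)^[r] y ++ [⟨r, hr⟩] := by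
  induction r with
  | zero =>
    have : z = ⟨0, hr⟩ := Fin.ext hz
    simp [this]
  | succ r ih =>
    rw [Function.iterate_succ_apply', Function.iterate_succ_apply', ih (by omega), sWord_append,
      sWord_singleton, sLetter_of_lt hz hr]
    simp [sWordSnoc]

theorem iterate_sWord_card_append_singleton {z : Fin k} (hz : (z : ℕ) = 0)
    (y : List (Fin k)) : sWord^[k] (y ++ [z]) = (sWordSnoc z)^[k] y := by
  obtain ⟨r, rfl⟩ : ∃ r, k = r + 1 := ⟨k - 1, by have := z.isLt; omega⟩
  rw [Function.iterate_succ_apply', Function.iterate_succ_apply',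
    iterate_sWord_append_singleton hz y (Nat.lt_succ_self r), sWord_append, sWord_singleton,
    sLetter_of_not_lt hz (by simp), sWordSnoc]

theorem iterate_sWord_isPrefix_iterate_sWordSnoc {z : Fin k} (hz : (z : ℕ) = 0) {n : ℕ}
    (hn : k ≤ n) : sWord^[n] [z] <+: (sWordSnoc z)^[n] [] := by
  induction n, hn using Nat.le_induction with
  | base =>
    have := iterate_sWord_card_append_singleton hz []
    rw [List.nil_append] at this
    rw [this]
  | succ n _ ih =>
    rw [Function.iterate_succ_apply', Function.iterate_succ_apply']
    exact (sWord_isPrefix ih).trans (List.prefix_append _ _)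

theorem occursAt_append {x : ℕ → Fin k} {u v : List (Fin k)} {d : ℕ} :
    OccursAt x (u ++ v) d ↔ OccursAt x u d ∧ OccursAt x v (d + u.length) := by
  induction u generalizing d with
  | nil => simp [OccursAt]
  | cons a u ih =>
    simp only [List.cons_append, OccursAt, ih, List.length_cons, and_assoc]
    rw [show d + 1 + u.length = d + (u.length + 1) by omega]

theorem OccursAt.of_isPrefix {x : ℕ → Fin k} {u v : List (Fin k)} {d : ℕ}
    (h : OccursAt x v d) (huv : u <+: v) : OccursAt x u d := by
  obtain ⟨t, rfl⟩ := huv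
  exact (occursAt_append.1 h).1

theorem occursAt_iff_map_range {x : ℕ → Fin k} {w : List (Fin k)} {d : ℕ} :
    OccursAt x w d ↔ (List.range w.length).map (fun i => x (d + i)) = w := by
  induction w generalizing d with
  | nil => simp [OccursAt]
  | cons a w ih =>
    have : (fun i => x (d + i)) ∘ Nat.succ = fun i => x (d + 1 + i) := by
      funext i
      simp only [Function.comp_apply]
      congr 1
      omega
    rw [OccursAt, ih, List.length_cons, List.range_succ_eq_map, List.map_cons, List.map_map, this,
      List.cons.injEq]
    rfl

end Words

section FixedPoint

variable {k : ℕ} {z : Fin k} {ω : ℕ → Fin k}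

theorem pref_length_sWord_pref (hω : sSeq ω = ω) (e : ℕ) :
    pref ω (sWord (pref ω e)).length = sWord (pref ω e) := by
  refine List.ext_getElem (length_pref _ _) fun i h₁ h₂ => ?_
  have hlen : i < (sWord (pref ω (i + 1))).length := by
    have := length_le_length_sWord (pref ω (i + 1))
    rw [length_pref] at this
    omega
  have h₃ : ω i = (sWord (pref ω (i + 1)))[i] := by
    conv_lhs => rw [← hω]
    rw [sSeq, List.getD_eq_getElem _ _ hlen]
  have h₄ : (pref ω (sWord (pref ω e)).length)[i] = ω i := by simp [pref]
  rw [h₄, h₃]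
  rcases le_total (i + 1) e with h | h
  · exact (sWord_isPrefix (pref_isPrefix ω h)).getElem hlen
  · exact ((sWord_isPrefix (pref_isPrefix ω h)).getElem h₂).symm

theorem blockStart_zero : blockStart ω 0 = 0 := by
  simp [blockStart, pref, sWord]

theorem blockStart_succ (e : ℕ) :
    blockStart ω (e + 1) = blockStart ω e + (sLetter (ω e)).length := by
  simp [blockStart, pref_succ, sWord_append, sWord_singleton]

theorem occursAt_sLetter_blockStart (hω : sSeq ω = ω) (e : ℕ) :
    OccursAt ω (sLetter (ω e)) (blockStart ω e) := by
  have h : OccursAt ω (sWord (pref ω (e + 1))) 0 := by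
    rw [occursAt_iff_map_range]
    simpa [pref] using pref_length_sWord_pref hω (e + 1)
  rw [pref_succ, sWord_append, occursAt_append, sWord_singleton, Nat.zero_add] at h
  exact h.2

theorem apply_blockStart (hz : (z : ℕ) = 0) (hω : sSeq ω = ω) (e : ℕ) :
    ω (blockStart ω e) = z := by
  have h := occursAt_sLetter_blockStart hω e
  by_cases hlt : (ω e : ℕ) + 1 < k
  · rw [sLetter_of_lt hz hlt] at h
    exact h.1
  · rw [sLetter_of_not_lt hz hlt] at h
    exact h.1

theorem exists_eq_blockStart_or (hz : (z : ℕ) = 0) (hω : sSeq ω = ω) (p : ℕ) :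
    (∃ e, p = blockStart ω e) ∨ (ω p ≠ z ∧ ∃ e, p + 1 = blockStart ω e) := by
  induction p with
  | zero => exact Or.inl ⟨0, blockStart_zero.symm⟩
  | succ p ih =>
    rcases ih with ⟨e, rfl⟩ | ⟨_, e, he⟩
    · have h := occursAt_sLetter_blockStart hω e
      have hs := blockStart_succ (ω := ω) e
      by_cases hlt : (ω e : ℕ) + 1 < k
      · rw [sLetter_of_lt hz hlt] at h hs
        refine Or.inr ⟨fun hc => ?_, e + 1, hs.symm⟩
        have := congrArg Fin.val (h.2.1.symm.trans hc)
        simp [hz] at this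
      · rw [sLetter_of_not_lt hz hlt] at hs
        exact Or.inl ⟨e + 1, hs.symm⟩
    · exact Or.inl ⟨e, he⟩

theorem exists_eq_blockStart_of_apply_eq (hz : (z : ℕ) = 0) (hω : sSeq ω = ω) {p : ℕ}
    (hp : ω p = z) : ∃ e, p = blockStart ω e :=
  (exists_eq_blockStart_or hz hω p).resolve_right fun h => h.1 hp

theorem apply_succ_of_apply_ne (hz : (z : ℕ) = 0) (hω : sSeq ω = ω) {p : ℕ}
    (hp : ω p ≠ z) : ω (p + 1) = z := by
  rcases exists_eq_blockStart_or hz hω p with ⟨e, rfl⟩ | ⟨_, e, he⟩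
  · exact absurd (apply_blockStart hz hω e) hp
  · rw [he]
    exact apply_blockStart hz hω e

theorem OccursAt.sWordSnoc_blockStart (hz : (z : ℕ) = 0) (hω : sSeq ω = ω)
    {w : List (Fin k)} {e : ℕ} (h : OccursAt ω w e) :
    OccursAt ω (sWordSnoc z w) (blockStart ω e) := by
  induction w generalizing e with
  | nil => exact ⟨apply_blockStart hz hω e, trivial⟩
  | cons a w ih =>
    obtain ⟨rfl, h⟩ := h
    rw [sWordSnoc, sWord_cons, List.append_assoc, occursAt_append, ← blockStart_succ]
    exact ⟨occursAt_sLetter_blockStart hω e, ih h⟩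

theorem exists_sWordSnoc_eq_cons (hz : (z : ℕ) = 0) (w : List (Fin k)) :
    ∃ t, sWordSnoc z w = z :: t := by
  cases w with
  | nil => exact ⟨[], rfl⟩
  | cons a w =>
    rw [sWordSnoc, sWord_cons]
    by_cases hlt : (a : ℕ) + 1 < k
    · rw [sLetter_of_lt hz hlt]
      exact ⟨_, rfl⟩
    · rw [sLetter_of_not_lt hz hlt]
      exact ⟨_, rfl⟩

theorem OccursAt.of_sWordSnoc_blockStart (hz : (z : ℕ) = 0) (hω : sSeq ω = ω)
    {w : List (Fin k)} {e : ℕ} (h : OccursAt ω (sWordSnoc z w) (blockStart ω e)) :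
    OccursAt ω w e := by
  induction w generalizing e with
  | nil => trivial
  | cons a w ih =>
    rw [sWordSnoc, sWord_cons, List.append_assoc, occursAt_append] at h
    obtain ⟨h₁, h₂⟩ := h
    have hb := occursAt_sLetter_blockStart hω e
    have hs := blockStart_succ (ω := ω) e
    have hea : ω e = a := by
      by_cases he : (ω e : ℕ) + 1 < k <;> by_cases ha : (a : ℕ) + 1 < k
      · rw [sLetter_of_lt hz he] at hb
        rw [sLetter_of_lt hz ha] at h₁
        have := congrArg Fin.val (hb.2.1.symm.trans h₁.2.1)
        exact Fin.ext (Nat.succ_injective this)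
      · rw [sLetter_of_lt hz he] at hb
        rw [sLetter_of_not_lt hz ha] at h₂
        obtain ⟨t, ht⟩ := exists_sWordSnoc_eq_cons hz w
        rw [sWordSnoc] at ht
        rw [ht] at h₂
        have := congrArg Fin.val (hb.2.1.symm.trans h₂.1)
        simp [hz] at this
      · rw [sLetter_of_not_lt hz he] at hs
        rw [sLetter_of_lt hz ha] at h₁
        have h₃ := apply_blockStart hz hω (e + 1)
        rw [hs] at h₃
        have := congrArg Fin.val (h₁.2.1.symm.trans h₃)
        simp [hz] at this
      · exact Fin.ext (by have := (ω e).isLt; have := a.isLt; omega)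
    refine ⟨hea, ih ?_⟩
    rw [hs, hea]
    exact h₂

theorem OccursAt.exists_of_sWordSnoc (hz : (z : ℕ) = 0) (hω : sSeq ω = ω)
    {w : List (Fin k)} {d : ℕ} (h : OccursAt ω (sWordSnoc z w) d) :
    ∃ e, d = blockStart ω e ∧ OccursAt ω w e := by
  obtain ⟨t, ht⟩ := exists_sWordSnoc_eq_cons hz w
  have hd : ω d = z := by
    rw [ht] at h
    exact h.1
  obtain ⟨e, rfl⟩ := exists_eq_blockStart_of_apply_eq hz hω hd
  exact ⟨e, rfl, h.of_sWordSnoc_blockStart hz hω⟩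

theorem occursAt_iterate_sWordSnoc_iff (hz : (z : ℕ) = 0) (hω : sSeq ω = ω)
    {w : List (Fin k)} {r d : ℕ} :
    OccursAt ω ((sWordSnoc z)^[r] w) d ↔ ∃ e, d = (blockStart ω)^[r] e ∧ OccursAt ω w e := by
  induction r generalizing d with
  | zero => simp
  | succ r ih =>
    simp only [Function.iterate_succ_apply']
    constructor
    · intro h
      obtain ⟨e, rfl, he⟩ := h.exists_of_sWordSnoc hz hω
      obtain ⟨f, rfl, hf⟩ := ih.1 he
      exact ⟨f, rfl, hf⟩
    · rintro ⟨e, rfl, he⟩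
      exact (ih.2 ⟨e, rfl, he⟩).sWordSnoc_blockStart hz hω

theorem iterate_blockStart (hω : sSeq ω = ω) (n e : ℕ) :
    pref ω ((blockStart ω)^[n] e) = sWord^[n] (pref ω e) := by
  induction n with
  | zero => rfl
  | succ n ih =>
    rw [Function.iterate_succ_apply', Function.iterate_succ_apply', blockStart,
      pref_length_sWord_pref hω, ih]

theorem iterate_blockStart_eq_length (hω : sSeq ω = ω) (n e : ℕ) :
    (blockStart ω)^[n] e = (sWord^[n] (pref ω e)).length := by
  rw [← iterate_blockStart hω, length_pref]

theorem exists_iterate_sWord_mul_eq (hk : 2 ≤ k) (hz : (z : ℕ) = 0) (hω : sSeq ω = ω)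
    (m : ℕ) : ∃ y, sWord^[k * m] [z] = y ++ [z] ∧
      ∀ d, OccursAt ω y d → ∃ e, d = (blockStart ω)^[k * m] e := by
  induction m with
  | zero => exact ⟨[], rfl, fun d _ => ⟨d, rfl⟩⟩
  | succ m ih =>
    obtain ⟨y, hy, hocc⟩ := ih
    obtain ⟨j, hj⟩ : ∃ j, k = j + 2 := ⟨k - 2, by omega⟩
    set u := (sWordSnoc z)^[j] y with hu
    have hiter : (sWordSnoc z)^[k] y = sWord (sWordSnoc z u) ++ [z] := by
      rw [show (sWordSnoc z)^[k] y = (sWordSnoc z)^[j + 2] y by rw [← hj],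
        Function.iterate_succ_apply', Function.iterate_succ_apply']
      rfl
    have hend : sWord (sWordSnoc z u)
        = (sWord (sWord u) ++ [z]) ++ [⟨(z : ℕ) + 1, by omega⟩] := by
      rw [sWordSnoc, sWord_append, sWord_singleton, sLetter_of_lt hz (by omega)]
      simp
    refine ⟨sWord (sWordSnoc z u), ?_, fun d hd => ?_⟩
    · rw [← hiter, Nat.mul_succ, Nat.add_comm, Function.iterate_add_apply, hy,
        iterate_sWord_card_append_singleton hz]
    · have hlast : OccursAt ω ((sWordSnoc z)^[k] y) d := by
        rw [hiter, occursAt_append]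
        refine ⟨hd, ?_, trivial⟩
        rw [hend, occursAt_append] at hd
        rw [hend, List.length_append, List.length_singleton, ← Nat.add_assoc]
        refine apply_succ_of_apply_ne hz hω fun hc => ?_
        have := congrArg Fin.val (hd.2.1.symm.trans hc)
        simp at this
      obtain ⟨e, rfl, he⟩ := (occursAt_iterate_sWordSnoc_iff hz hω).1 hlast
      obtain ⟨f, rfl⟩ := hocc e he
      exact ⟨f, by rw [Nat.mul_succ, Nat.add_comm, Function.iterate_add_apply]⟩

theorem OccursAt.exists_eq_iterate_blockStart (hk : 2 ≤ k) (hz : (z : ℕ) = 0)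
    (hω : sSeq ω = ω) {n d : ℕ} (h : OccursAt ω (sWord^[n] [z]) d) :
    ∃ e, d = (blockStart ω)^[n] e := by
  obtain ⟨y, hy, hocc⟩ := exists_iterate_sWord_mul_eq hk hz hω (n / k)
  have hn : n = n % k + k * (n / k) := (Nat.mod_add_div n k).symm
  rw [hn, Function.iterate_add_apply, hy,
    iterate_sWord_append_singleton hz y (Nat.mod_lt n (by omega)), occursAt_append] at h
  obtain ⟨e, rfl, he⟩ := (occursAt_iterate_sWordSnoc_iff hz hω).1 h.1
  obtain ⟨f, rfl⟩ := hocc e he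
  exact ⟨f, by rw [← Function.iterate_add_apply, ← hn]⟩

theorem occursAt_iterate_blockStart (hz : (z : ℕ) = 0) (hω : sSeq ω = ω) {n : ℕ}
    (hn : k ≤ n) (e : ℕ) : OccursAt ω (sWord^[n] [z]) ((blockStart ω)^[n] e) :=
  ((occursAt_iterate_sWordSnoc_iff hz hω (w := [])).2 ⟨e, rfl, trivial⟩).of_isPrefix
    (iterate_sWord_isPrefix_iterate_sWordSnoc hz hn)

end FixedPoint

theorem stmt4 (k : ℕ) (hk : 2 ≤ k) (z0 : Fin k) (hz : (z0 : ℕ) = 0)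
    (ω : ℕ → Fin k) (hω : sSeq ω = ω) (n : ℕ) (hn : k ≤ n) (d : ℕ) :
    (List.range (sWord^[n] [z0]).length).map (fun i => ω (d + i)) = sWord^[n] [z0]
      ↔ (d = 0 ∨ ∃ m : ℕ, d = (sWord^[n] (pref ω (m + 1))).length) := by
  have hzero : (blockStart ω)^[n] 0 = 0 := Function.iterate_fixed blockStart_zero n
  rw [← occursAt_iff_map_range]
  constructor
  · intro h
    obtain ⟨e, rfl⟩ := h.exists_eq_iterate_blockStart hk hz hω
    cases e with
    | zero => exact Or.inl hzero
    | succ m => exact Or.inr ⟨m, iterate_blockStart_eq_length hω n (m + 1)⟩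
  · rintro (rfl | ⟨m, rfl⟩)
    · rw [← hzero]
      exact occursAt_iterate_blockStart hz hω hn 0
    · rw [← iterate_blockStart_eq_length hω]
      exact occursAt_iterate_blockStart hz hω hn (m + 1)
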